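/- For every triangulation T of P and every internal diagonal δ of P, the equality Σ_{j∈Bel(δ)} x_j(T) = (bel(δ)+1)·bel(δ)/2 holds if and only if δ ∈ T. -/

import Mathlib

attribute [local instance] Classical.propDecidable

noncomputable section

namespace Spines

/-- Position of vertex `v ∈ {0,…,n+2}` in the counterclockwise boundary cyclic order:
`0`, then the elements of `D` in increasing order, then `n+2`, then the elements of `U`
in decreasing order. -/
def pos (n : ℕ) (D U : Finset ℕ) (v : ℕ) : ℕ :=
  if v = 0 then 0
  else if v = n + 2 then D.card + 1
  else if v ∈ D then 1 + (D.filter (fun d => d < v)).card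
  else D.card + 2 + (U.filter (fun u => v < u)).card

/-- Cyclic distance from `a` to `v` in counterclockwise direction. -/
def relpos (n : ℕ) (D U : Finset ℕ) (a v : ℕ) : ℕ :=
  (pos n D U v + (n + 3) - pos n D U a) % (n + 3)

/-- `v` lies strictly inside the counterclockwise boundary arc from `a` to `b`. -/
def StrictBetween (n : ℕ) (D U : Finset ℕ) (a b v : ℕ) : Prop :=
  v ≤ n + 2 ∧ 0 < relpos n D U a v ∧ relpos n D U a v < relpos n D U a b

/-- A diagonal, encoded as an ordered pair `(a,b)` with `a < b ≤ n+2`. -/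
def IsDiag (n : ℕ) (δ : ℕ × ℕ) : Prop := δ.1 < δ.2 ∧ δ.2 ≤ n + 2

/-- A boundary edge: the endpoints are adjacent in the cyclic order. -/
def IsBoundaryEdge (n : ℕ) (D U : Finset ℕ) (δ : ℕ × ℕ) : Prop :=
  IsDiag n δ ∧ (relpos n D U δ.1 δ.2 = 1 ∨ relpos n D U δ.2 δ.1 = 1)

/-- An internal diagonal. -/
def IsInternalDiag (n : ℕ) (D U : Finset ℕ) (δ : ℕ × ℕ) : Prop :=
  IsDiag n δ ∧ ¬ IsBoundaryEdge n D U δ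

/-- Two diagonals cross: the four endpoints are pairwise distinct and exactly one
endpoint of the second lies strictly inside each of the two arcs determined by the first. -/
def Cross (n : ℕ) (D U : Finset ℕ) (δ δ' : ℕ × ℕ) : Prop :=
  δ.1 ≠ δ.2 ∧ δ'.1 ≠ δ'.2 ∧ δ.1 ≠ δ'.1 ∧ δ.1 ≠ δ'.2 ∧ δ.2 ≠ δ'.1 ∧ δ.2 ≠ δ'.2 ∧
  ((StrictBetween n D U δ.1 δ.2 δ'.1 ∧ StrictBetween n D U δ.2 δ.1 δ'.2) ∨
   (StrictBetween n D U δ.1 δ.2 δ'.2 ∧ StrictBetween n D U δ.2 δ.1 δ'.1))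

/-- A triangulation: a maximal set of pairwise non-crossing internal diagonals. -/
def IsTriangulation (n : ℕ) (D U : Finset ℕ) (T : Finset (ℕ × ℕ)) : Prop :=
  (∀ δ ∈ T, IsInternalDiag n D U δ) ∧
  (∀ δ ∈ T, ∀ δ' ∈ T, ¬ Cross n D U δ δ') ∧
  (∀ δ, IsInternalDiag n D U δ → δ ∉ T → ∃ δ' ∈ T, Cross n D U δ δ')

/-- `a` and `b` (with `a < b`) are joined by a diagonal of `T` or a boundary edge. -/
def EdgeOf (n : ℕ) (D U : Finset ℕ) (T : Finset (ℕ × ℕ)) (a b : ℕ) : Prop :=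
  (a, b) ∈ T ∨ IsBoundaryEdge n D U (a, b)

/-- `{i,j,k}` with `i<j<k` is a triangle of the triangulation `T`. -/
def IsTriangleOf (n : ℕ) (D U : Finset ℕ) (T : Finset (ℕ × ℕ)) (i j k : ℕ) : Prop :=
  i < j ∧ j < k ∧ k ≤ n + 2 ∧
    EdgeOf n D U T i j ∧ EdgeOf n D U T j k ∧ EdgeOf n D U T i k

/-- `Bel δ`: labels in `[n+1]` strictly inside the ccw arc from `δ.1` to `δ.2`,
together with the endpoints of `δ` lying in `U`. -/
def Bel (n : ℕ) (D U : Finset ℕ) (δ : ℕ × ℕ) : Finset ℕ :=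
  (Finset.Icc 1 (n + 1)).filter
    (fun j => StrictBetween n D U δ.1 δ.2 j ∨ (j ∈ U ∧ (j = δ.1 ∨ j = δ.2)))

def bel (n : ℕ) (D U : Finset ℕ) (δ : ℕ × ℕ) : ℕ := (Bel n D U δ).card

def Abo (n : ℕ) (D U : Finset ℕ) (δ : ℕ × ℕ) : Finset ℕ :=
  Finset.Icc 1 (n + 1) \ Bel n D U δ

/-- The coordinates of the point `x(T)` associated to a triangulation `T`. -/
def xcoord (n : ℕ) (D U : Finset ℕ) (T : Finset (ℕ × ℕ)) (j : ℕ) : ℝ :=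
  if h : ∃ p : ℕ × ℕ, IsTriangleOf n D U T p.1 j p.2 then
    if j ∈ D then
      ((bel n D U (h.choose.1, j) : ℝ) + 1) * ((bel n D U (j, h.choose.2) : ℝ) + 1)
    else
      ((n : ℝ) + 2) -
        (((n : ℝ) + 2) - (bel n D U (h.choose.1, j) : ℝ)) *
          (((n : ℝ) + 2) - (bel n D U (j, h.choose.2) : ℝ))
  else 0

/-- Middle vertex of the triple `{a,b,c}` with `a < b` and `c ∉ {a,b}`. -/
def midOf (a b c : ℕ) : ℕ := if c < a then a else if c < b then c else b

/-- `c` is the third vertex of a triangle of `T` containing the diagonal `δ`. -/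
def TriWith (n : ℕ) (D U : Finset ℕ) (T : Finset (ℕ × ℕ)) (δ : ℕ × ℕ) (c : ℕ) : Prop :=
  if c < δ.1 then IsTriangleOf n D U T c δ.1 δ.2
  else if c < δ.2 then IsTriangleOf n D U T δ.1 c δ.2
  else IsTriangleOf n D U T δ.1 δ.2 c

/-- `s_δ`: middle vertex of the triangle of `T` below `δ` (third vertex strictly
inside the ccw arc from `δ.1` to `δ.2`). -/
def spineSrc (n : ℕ) (D U : Finset ℕ) (T : Finset (ℕ × ℕ)) (δ : ℕ × ℕ) : ℕ :=
  if h : ∃ c, StrictBetween n D U δ.1 δ.2 c ∧ TriWith n D U T δ c then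
    midOf δ.1 δ.2 h.choose
  else 0

/-- `t_δ`: middle vertex of the triangle of `T` above `δ` (third vertex strictly
inside the ccw arc from `δ.2` to `δ.1`). -/
def spineTgt (n : ℕ) (D U : Finset ℕ) (T : Finset (ℕ × ℕ)) (δ : ℕ × ℕ) : ℕ :=
  if h : ∃ c, StrictBetween n D U δ.2 δ.1 c ∧ TriWith n D U T δ c then
    midOf δ.1 δ.2 h.choose
  else 0

/-- `(p,q)` is an arc of the spine of `T`. -/
def SpineArc (n : ℕ) (D U : Finset ℕ) (T : Finset (ℕ × ℕ)) (p q : ℕ) : Prop :=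
  ∃ δ ∈ T, spineSrc n D U T δ = p ∧ spineTgt n D U T δ = q

/-- The finite set of all triangulations of the polygon. -/
def allTri (n : ℕ) (D U : Finset ℕ) : Finset (Finset (ℕ × ℕ)) :=
  ((Finset.range (n + 3) ×ˢ Finset.range (n + 3)).filter
      (fun δ => IsInternalDiag n D U δ)).powerset.filter
    (fun T => IsTriangulation n D U T)

end Spines

namespace Spines

/-- Strict cyclic order of three natural numbers. -/
def Cyc (x y z : ℕ) : Prop := (x < y ∧ y < z) ∨ (y < z ∧ z < x) ∨ (z < x ∧ x < y)

theorem Cyc.rotate {x y z : ℕ} (h : Cyc x y z) : Cyc y z x := by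
  simp only [Cyc] at *
  omega

theorem Cyc.trans_left {x y z w : ℕ} (h : Cyc x y z) (h' : Cyc x z w) : Cyc x y w ∧ Cyc y z w := by
  simp only [Cyc] at *
  omega

theorem Cyc.trans_right {x y z w : ℕ} (h : Cyc x y w) (h' : Cyc y z w) :
    Cyc x z w ∧ Cyc x y z := by
  simp only [Cyc] at *
  omega

theorem Cyc.eq_or {b c v : ℕ} (h : Cyc b v c) (a : ℕ) :
    v = a ∨ Cyc b v a ∨ Cyc a v c := by
  simp only [Cyc] at *
  omega

theorem Cyc.ne {x y z : ℕ} (h : Cyc x y z) : x ≠ y ∧ y ≠ z ∧ x ≠ z := by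
  simp only [Cyc] at *
  omega

theorem cyc_or_cyc {x y z : ℕ} (hxy : x ≠ y) (hxz : x ≠ z) (hyz : y ≠ z) :
    Cyc x y z ∨ Cyc x z y := by
  simp only [Cyc]
  omega

theorem Cyc.split_iff {a b c j : ℕ} (h : Cyc a c b) (hj : j ≠ c) :
    (Cyc a j b ↔ Cyc a j c ∨ Cyc c j b) ∧ ¬ (Cyc a j c ∧ Cyc c j b) := by
  have hnot : ¬ (Cyc a j c ∧ Cyc c j b) := by
    rintro ⟨h1, h2⟩
    simp only [Cyc] at h1 h2 h
    omega
  refine ⟨⟨fun h' => ?_, ?_⟩, hnot⟩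
  · simp only [Cyc] at h h' ⊢
    omega
  · rintro (h' | h')
    · exact (h'.trans_left h).1
    · exact (h.trans_right h').1

section Position

variable {n : ℕ} {D U : Finset ℕ}

theorem mem_down_or_up (hUD : D ∪ U = Finset.Icc 1 (n + 1)) (v : ℕ) :
    (v ∈ D ∨ v ∈ U) ↔ (1 ≤ v ∧ v ≤ n + 1) := by
  rw [← Finset.mem_union, hUD, Finset.mem_Icc]

theorem not_mem_down_and_up (hdisj : Disjoint D U) (v : ℕ) : ¬ (v ∈ D ∧ v ∈ U) :=
  fun h => Finset.disjoint_left.mp hdisj h.1 h.2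

theorem card_down_add_card_up (hUD : D ∪ U = Finset.Icc 1 (n + 1)) (hdisj : Disjoint D U) :
    D.card + U.card = n + 1 := by
  rw [← Finset.card_union_of_disjoint hdisj, hUD]
  simp

theorem pos_zero : pos n D U 0 = 0 := by simp [pos]

theorem pos_last : pos n D U (n + 2) = D.card + 1 := by simp [pos]

theorem pos_of_mem_down (hUD : D ∪ U = Finset.Icc 1 (n + 1)) {v : ℕ} (hv : v ∈ D) :
    pos n D U v = 1 + (D.filter (fun d => d < v)).card := by
  have := (mem_down_or_up hUD v).1 (Or.inl hv)
  rw [pos, if_neg (by omega), if_neg (by omega), if_pos hv]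

theorem pos_of_mem_up (hUD : D ∪ U = Finset.Icc 1 (n + 1)) (hdisj : Disjoint D U) {v : ℕ}
    (hv : v ∈ U) : pos n D U v = D.card + 2 + (U.filter (fun u => v < u)).card := by
  have := (mem_down_or_up hUD v).1 (Or.inr hv)
  rw [pos, if_neg (by omega), if_neg (by omega),
    if_neg (fun h => not_mem_down_and_up hdisj v ⟨h, hv⟩)]

theorem card_filter_lt_lt {S : Finset ℕ} {v w : ℕ} (hv : v ∈ S) (h : v < w) :
    (S.filter (fun d => d < v)).card < (S.filter (fun d => d < w)).card := by
  apply Finset.card_lt_card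
  rw [Finset.ssubset_iff_of_subset]
  · exact ⟨v, by simp [hv, h], by simp⟩
  · intro x hx
    simp only [Finset.mem_filter] at hx ⊢
    exact ⟨hx.1, by omega⟩

theorem card_filter_gt_lt {S : Finset ℕ} {v w : ℕ} (hw : w ∈ S) (h : v < w) :
    (S.filter (fun d => w < d)).card < (S.filter (fun d => v < d)).card := by
  apply Finset.card_lt_card
  rw [Finset.ssubset_iff_of_subset]
  · exact ⟨w, by simp [hw, h], by simp⟩
  · intro x hx
    simp only [Finset.mem_filter] at hx ⊢
    exact ⟨hx.1, by omega⟩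

theorem card_filter_irrefl_lt {S : Finset ℕ} {v : ℕ} (p : ℕ → Prop) [DecidablePred p]
    (hv : v ∈ S) (h : ¬ p v) :
    (S.filter p).card < S.card := by
  apply Finset.card_lt_card
  rw [Finset.ssubset_iff_of_subset (Finset.filter_subset _ _)]
  exact ⟨v, hv, by simp [h]⟩

/-- Which part of the boundary a vertex lies on, in terms of its position. -/
theorem pos_spec (hUD : D ∪ U = Finset.Icc 1 (n + 1)) (hdisj : Disjoint D U) {v : ℕ}
    (hv : v ≤ n + 2) :
    D.card ≤ n + 1 ∧
    ((v = 0 ∧ pos n D U v = 0 ∧ v ∉ D ∧ v ∉ U) ∨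
    (v = n + 2 ∧ pos n D U v = D.card + 1 ∧ v ∉ D ∧ v ∉ U) ∨
    (1 ≤ v ∧ v ≤ n + 1 ∧ v ∈ D ∧ v ∉ U ∧ 1 ≤ pos n D U v ∧ pos n D U v ≤ D.card) ∨
    (1 ≤ v ∧ v ≤ n + 1 ∧ v ∉ D ∧ v ∈ U ∧ D.card + 2 ≤ pos n D U v ∧ pos n D U v ≤ n + 2)) := by
  have hc := card_down_add_card_up hUD hdisj
  refine ⟨by omega, ?_⟩
  have hm := mem_down_or_up hUD v
  have hd := not_mem_down_and_up hdisj v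
  by_cases h0 : v = 0
  · subst h0
    have : (0 : ℕ) ∉ D ∧ (0 : ℕ) ∉ U := by
      constructor <;> intro h <;> simp_all
    exact Or.inl ⟨rfl, pos_zero, this⟩
  by_cases h1 : v = n + 2
  · subst h1
    have : n + 2 ∉ D ∧ n + 2 ∉ U := by
      constructor <;> intro h
      · have := hm.1 (Or.inl h); omega
      · have := hm.1 (Or.inr h); omega
    exact Or.inr (Or.inl ⟨rfl, pos_last, this⟩)
  rcases hm.2 (by omega) with h | h
  · have hp := pos_of_mem_down hUD h
    have := card_filter_irrefl_lt (fun d => d < v) h (lt_irrefl v)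
    exact Or.inr (Or.inr (Or.inl ⟨by omega, by omega, h, fun h' => hd ⟨h, h'⟩, by omega, by omega⟩))
  · have hp := pos_of_mem_up hUD hdisj h
    have := card_filter_irrefl_lt (fun d => v < d) h (lt_irrefl v)
    exact Or.inr (Or.inr (Or.inr ⟨by omega, by omega, fun h' => hd ⟨h', h⟩, h, by omega, by omega⟩))

/-- Positions increase along the lower part of the boundary and decrease along the upper part. -/
theorem pos_lt_of_lt (hUD : D ∪ U = Finset.Icc 1 (n + 1)) (hdisj : Disjoint D U) {v w : ℕ}
    (hw : w ≤ n + 2) (h : v < w) :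
    (pos n D U w ≤ D.card + 1 → pos n D U v ≤ D.card + 1 → pos n D U v < pos n D U w) ∧
    (D.card + 1 ≤ pos n D U v → D.card + 1 ≤ pos n D U w → pos n D U w < pos n D U v) := by
  obtain ⟨-, hv'⟩ := pos_spec hUD hdisj (v := v) (by omega)
  obtain ⟨-, hw'⟩ := pos_spec hUD hdisj hw
  constructor
  · intro h1 h2
    rcases hv' with hv' | hv' | hv' | hv' <;> rcases hw' with hw' | hw' | hw' | hw' <;> try omega
    have := card_filter_lt_lt hv'.2.2.1 h
    rw [pos_of_mem_down hUD hv'.2.2.1, pos_of_mem_down hUD hw'.2.2.1]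
    omega
  · intro h1 h2
    rcases hv' with hv' | hv' | hv' | hv' <;> rcases hw' with hw' | hw' | hw' | hw' <;> try omega
    have := card_filter_gt_lt hw'.2.2.2.1 h
    rw [pos_of_mem_up hUD hdisj hv'.2.2.2.1, pos_of_mem_up hUD hdisj hw'.2.2.2.1]
    omega

theorem pos_le (hUD : D ∪ U = Finset.Icc 1 (n + 1)) (hdisj : Disjoint D U) {v : ℕ}
    (hv : v ≤ n + 2) : pos n D U v ≤ n + 2 := by
  have := pos_spec hUD hdisj hv
  omega

theorem pos_injective (hUD : D ∪ U = Finset.Icc 1 (n + 1)) (hdisj : Disjoint D U) {v w : ℕ}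
    (hv : v ≤ n + 2) (hw : w ≤ n + 2) (h : pos n D U v = pos n D U w) : v = w := by
  rcases lt_trichotomy v w with hlt | heq | hlt
  · have := pos_lt_of_lt hUD hdisj hw hlt
    omega
  · exact heq
  · have := pos_lt_of_lt hUD hdisj hv hlt
    omega

theorem exists_pos_eq (hUD : D ∪ U = Finset.Icc 1 (n + 1)) (hdisj : Disjoint D U) {q : ℕ}
    (hq : q ≤ n + 2) : ∃ v ≤ n + 2, pos n D U v = q := by
  have h := Finset.surj_on_of_inj_on_of_card_le (s := Finset.range (n + 3))
    (t := Finset.range (n + 3)) (fun v _ => pos n D U v)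
    (fun v hv => by
      have := pos_le hUD hdisj (v := v) (by simp at hv; omega)
      simp; omega)
    (fun v w hv hw h => pos_injective hUD hdisj (by simp at hv; omega) (by simp at hw; omega) h)
    le_rfl q (by simp; omega)
  obtain ⟨v, hv, rfl⟩ := h
  exact ⟨v, by simp at hv; omega, rfl⟩

theorem relpos_spec (hUD : D ∪ U = Finset.Icc 1 (n + 1)) (hdisj : Disjoint D U) {a v : ℕ}
    (ha : a ≤ n + 2) (hv : v ≤ n + 2) :
    (pos n D U a ≤ pos n D U v ∧ relpos n D U a v + pos n D U a = pos n D U v) ∨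
    (pos n D U v < pos n D U a ∧ relpos n D U a v + pos n D U a = pos n D U v + (n + 3)) := by
  have h1 := pos_le hUD hdisj ha
  have h2 := pos_le hUD hdisj hv
  rw [relpos]
  generalize pos n D U a = p at *
  generalize pos n D U v = q at *
  rcases le_or_gt p q with h | h
  · left
    rw [show q + (n + 3) - p = (q - p) + (n + 3) by omega, Nat.add_mod_right,
      Nat.mod_eq_of_lt (by omega)]
    omega
  · right
    rw [Nat.mod_eq_of_lt (by omega)]
    omega

theorem strictBetween_iff (hUD : D ∪ U = Finset.Icc 1 (n + 1)) (hdisj : Disjoint D U)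
    {a b v : ℕ} (ha : a ≤ n + 2) (hb : b ≤ n + 2) (hv : v ≤ n + 2) :
    StrictBetween n D U a b v ↔ Cyc (pos n D U a) (pos n D U v) (pos n D U b) := by
  have h1 := relpos_spec hUD hdisj ha hb
  have h2 := relpos_spec hUD hdisj ha hv
  have h3 := pos_le hUD hdisj ha
  have h4 := pos_le hUD hdisj hb
  have h5 := pos_le hUD hdisj hv
  rw [StrictBetween, Cyc]
  omega

/-- Crossing of diagonals in terms of cyclic order of positions. -/
theorem cross_iff (hUD : D ∪ U = Finset.Icc 1 (n + 1)) (hdisj : Disjoint D U)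
    {a b c d : ℕ} (ha : a ≤ n + 2) (hb : b ≤ n + 2) (hc : c ≤ n + 2) (hd : d ≤ n + 2) :
    Cross n D U (a, b) (c, d) ↔
      (Cyc (pos n D U a) (pos n D U c) (pos n D U b) ∧
        Cyc (pos n D U b) (pos n D U d) (pos n D U a)) ∨
      (Cyc (pos n D U a) (pos n D U d) (pos n D U b) ∧
        Cyc (pos n D U b) (pos n D U c) (pos n D U a)) := by
  rw [Cross]
  simp only [strictBetween_iff hUD hdisj ha hb hc, strictBetween_iff hUD hdisj ha hb hd,
    strictBetween_iff hUD hdisj hb ha hc, strictBetween_iff hUD hdisj hb ha hd]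
  constructor
  · tauto
  · intro h
    have key : ∀ x y : ℕ, pos n D U x ≠ pos n D U y → x ≠ y := fun x y h e => h (by rw [e])
    refine ⟨key _ _ ?_, key _ _ ?_, key _ _ ?_, key _ _ ?_, key _ _ ?_, key _ _ ?_, h⟩ <;>
    · simp only [Cyc] at h
      omega

end Position

/-- `a` and `b`, in either order, are joined by a diagonal of `T` or a boundary edge. -/
def Joined (n : ℕ) (D U : Finset ℕ) (T : Finset (ℕ × ℕ)) (a b : ℕ) : Prop :=
  (a < b ∧ EdgeOf n D U T a b) ∨ (b < a ∧ EdgeOf n D U T b a)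

section Triangulation

variable {n : ℕ} {D U : Finset ℕ} {T : Finset (ℕ × ℕ)}

theorem Joined.symm {a b : ℕ} (h : Joined n D U T a b) : Joined n D U T b a := Or.symm h

theorem EdgeOf.bounds (hT : IsTriangulation n D U T) {a b : ℕ} (h : EdgeOf n D U T a b) :
    a < b ∧ b ≤ n + 2 :=
  h.elim (fun h => (hT.1 _ h).1) (fun h => h.1)

theorem EdgeOf.joined (hT : IsTriangulation n D U T) {a b : ℕ} (h : EdgeOf n D U T a b) :
    Joined n D U T a b :=
  Or.inl ⟨(h.bounds hT).1, h⟩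

theorem Joined.bounds (hT : IsTriangulation n D U T) {a b : ℕ} (h : Joined n D U T a b) :
    a ≤ n + 2 ∧ b ≤ n + 2 ∧ a ≠ b := by
  rcases h with ⟨-, h⟩ | ⟨-, h⟩ <;> have := h.bounds hT <;> omega

theorem Joined.edgeOf_of_lt {a b : ℕ} (h : Joined n D U T a b) (hab : a < b) :
    EdgeOf n D U T a b := by
  rcases h with h | h
  · exact h.2
  · omega

theorem joined_of_relpos_eq_one {a b : ℕ} (ha : a ≤ n + 2)
    (hb : b ≤ n + 2) (h : relpos n D U a b = 1) (hne : a ≠ b) : Joined n D U T a b := by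
  rcases lt_or_gt_of_ne hne with hlt | hlt
  · exact Or.inl ⟨hlt, Or.inr ⟨⟨hlt, hb⟩, Or.inl h⟩⟩
  · exact Or.inr ⟨hlt, Or.inr ⟨⟨hlt, ha⟩, Or.inr h⟩⟩

theorem IsBoundaryEdge.not_separating (hUD : D ∪ U = Finset.Icc 1 (n + 1))
    (hdisj : Disjoint D U) {a b c d : ℕ} (h : IsBoundaryEdge n D U (a, b)) (hc : c ≤ n + 2)
    (hd : d ≤ n + 2) :
    ¬ (Cyc (pos n D U a) (pos n D U c) (pos n D U b) ∧
      Cyc (pos n D U b) (pos n D U d) (pos n D U a)) := by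
  obtain ⟨⟨hab, hb⟩, h⟩ := h
  simp only at hab hb h
  have h1 := relpos_spec hUD hdisj (show a ≤ n + 2 by omega) hb
  have h2 := relpos_spec hUD hdisj hb (show a ≤ n + 2 by omega)
  have h3 := pos_le hUD hdisj hc
  have h4 := pos_le hUD hdisj hd
  have h5 := pos_le hUD hdisj hb
  have h6 := pos_le hUD hdisj (show a ≤ n + 2 by omega)
  simp only [Cyc]
  omega

theorem EdgeOf.not_cross (hUD : D ∪ U = Finset.Icc 1 (n + 1)) (hdisj : Disjoint D U)
    (hT : IsTriangulation n D U T) {a b c d : ℕ}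
    (h : EdgeOf n D U T a b) (h' : EdgeOf n D U T c d) :
    ¬ ((Cyc (pos n D U a) (pos n D U c) (pos n D U b) ∧
        Cyc (pos n D U b) (pos n D U d) (pos n D U a)) ∨
      (Cyc (pos n D U a) (pos n D U d) (pos n D U b) ∧
        Cyc (pos n D U b) (pos n D U c) (pos n D U a))) := by
  have hb := h.bounds hT
  have hb' := h'.bounds hT
  rcases h with h | h
  · rcases h' with h' | h'
    · rw [← cross_iff hUD hdisj (by omega) (by omega) (by omega) (by omega)]
      exact hT.2.1 _ h _ h'
    · have h1 := h'.not_separating hUD hdisj (c := a) (d := b) (by omega) (by omega)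
      have h2 := h'.not_separating hUD hdisj (c := b) (d := a) (by omega) (by omega)
      simp only [Cyc] at *
      omega
  · have h1 := h.not_separating hUD hdisj (c := c) (d := d) (by omega) (by omega)
    have h2 := h.not_separating hUD hdisj (c := d) (d := c) (by omega) (by omega)
    tauto

theorem Joined.not_cross (hUD : D ∪ U = Finset.Icc 1 (n + 1)) (hdisj : Disjoint D U)
    (hT : IsTriangulation n D U T) {a b c d : ℕ}
    (h : Joined n D U T a b) (h' : Joined n D U T c d) :
    ¬ (Cyc (pos n D U a) (pos n D U c) (pos n D U b) ∧
      Cyc (pos n D U b) (pos n D U d) (pos n D U a)) := by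
  rcases h with ⟨-, h⟩ | ⟨-, h⟩ <;> rcases h' with ⟨-, h'⟩ | ⟨-, h'⟩ <;>
  · have := h.not_cross hUD hdisj hT h'
    simp only [Cyc] at *
    omega

/-- A diagonal that is not an edge of `T` is crossed by a diagonal of `T`. -/
theorem exists_mem_cross (hT : IsTriangulation n D U T) {a b : ℕ}
    (hab : a < b) (hb : b ≤ n + 2) (h : ¬ EdgeOf n D U T a b) :
    ∃ δ ∈ T, Cross n D U (a, b) δ := by
  rw [EdgeOf, not_or] at h
  exact hT.2.2 (a, b) ⟨⟨hab, hb⟩, h.2⟩ h.1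

theorem exists_joined_cross (hUD : D ∪ U = Finset.Icc 1 (n + 1)) (hdisj : Disjoint D U)
    (hT : IsTriangulation n D U T) {a b : ℕ}
    (ha : a ≤ n + 2) (hb : b ≤ n + 2) (hne : a ≠ b) (h : ¬ Joined n D U T a b) :
    ∃ c d, Joined n D U T c d ∧ Cyc (pos n D U a) (pos n D U c) (pos n D U b) ∧
      Cyc (pos n D U b) (pos n D U d) (pos n D U a) := by
  wlog hlt : a < b generalizing a b
  · obtain ⟨c, d, h1, h2, h3⟩ := this hb ha hne.symm (fun h' => h h'.symm) (by omega)
    exact ⟨d, c, h1.symm, h3, h2⟩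
  obtain ⟨⟨c, d⟩, hmem, hcr⟩ := exists_mem_cross hT hlt hb (fun h' => h (Or.inl ⟨hlt, h'⟩))
  have hj : Joined n D U T c d := EdgeOf.joined hT (Or.inl hmem)
  have := hj.bounds hT
  rw [cross_iff hUD hdisj ha hb this.1 this.2.1] at hcr
  rcases hcr with h | h
  · exact ⟨c, d, hj, h⟩
  · exact ⟨d, c, hj.symm, h⟩

/-- Every edge which is not a boundary edge with nothing on its right
bounds a triangle on its right. -/
theorem Joined.exists_third (hUD : D ∪ U = Finset.Icc 1 (n + 1)) (hdisj : Disjoint D U)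
    (hT : IsTriangulation n D U T) {a b : ℕ}
    (h : Joined n D U T a b) (h1 : relpos n D U a b ≠ 1) :
    ∃ c ≤ n + 2, Cyc (pos n D U a) (pos n D U c) (pos n D U b) ∧
      Joined n D U T a c ∧ Joined n D U T c b := by
  obtain ⟨ha, hb, hne⟩ := h.bounds hT
  have hpa := pos_le hUD hdisj ha
  have hpb := pos_le hUD hdisj hb
  have hpne : pos n D U a ≠ pos n D U b := fun e => hne (pos_injective hUD hdisj ha hb e)
  have hab := relpos_spec hUD hdisj ha hb
  set S := (Finset.range (n + 3)).filter (fun c =>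
    Cyc (pos n D U a) (pos n D U c) (pos n D U b) ∧ Joined n D U T a c) with hS
  have hne : S.Nonempty := by
    obtain ⟨c, hc, hpc⟩ := exists_pos_eq hUD hdisj
      (q := if pos n D U a = n + 2 then 0 else pos n D U a + 1) (by split_ifs <;> omega)
    have hac := relpos_spec hUD hdisj ha hc
    refine ⟨c, ?_⟩
    rw [hS, Finset.mem_filter, Finset.mem_range]
    refine ⟨by omega, ?_, joined_of_relpos_eq_one ha hc ?_ ?_⟩
    · rw [Cyc]
      split_ifs at hpc <;> omega
    · split_ifs at hpc <;> omega
    · rintro rfl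
      split_ifs at hpc <;> omega
  obtain ⟨c, hcS, hmax⟩ := S.exists_max_image (fun c => relpos n D U a c) hne
  rw [hS, Finset.mem_filter, Finset.mem_range] at hcS
  obtain ⟨hc, hcyc, hac⟩ := hcS
  have hc : c ≤ n + 2 := by omega
  refine ⟨c, hc, hcyc, hac, ?_⟩
  by_contra hcb
  obtain ⟨u, v, huv, hu, hv⟩ := exists_joined_cross hUD hdisj hT hc hb
    (by rintro rfl; exact hcyc.ne.2.1 rfl) hcb
  obtain ⟨hu', hv', -⟩ := huv.bounds hT
  obtain ⟨hub, hcu⟩ := hcyc.trans_right hu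
  rcases hv.eq_or (pos n D U a) with hva | hva | hva
  · obtain rfl := pos_injective hUD hdisj hv' ha hva
    have hmem : u ∈ S := by
      rw [hS, Finset.mem_filter, Finset.mem_range]
      exact ⟨by omega, hub, huv.symm⟩
    have hlt := ((strictBetween_iff hUD hdisj ha hu' hc).2 hcu).2.2
    have := hmax u hmem
    omega
  · exact h.not_cross hUD hdisj hT huv ⟨hub, hva⟩
  · exact hac.not_cross hUD hdisj hT huv.symm ⟨hva, hcu.rotate⟩

theorem cyc_of_lt_of_lt (hUD : D ∪ U = Finset.Icc 1 (n + 1)) (hdisj : Disjoint D U)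
    {i j k : ℕ} (hij : i < j) (hjk : j < k) (hk : k ≤ n + 2) :
    (j ∈ D → Cyc (pos n D U j) (pos n D U k) (pos n D U i)) ∧
    (j ∉ D → Cyc (pos n D U j) (pos n D U i) (pos n D U k)) := by
  have pi := pos_spec hUD hdisj (v := i) (by omega)
  have pj := pos_spec hUD hdisj (v := j) (by omega)
  have pk := pos_spec hUD hdisj hk
  have o1 := pos_lt_of_lt hUD hdisj (by omega) hij
  have o2 := pos_lt_of_lt hUD hdisj (by omega) hjk
  have o3 := pos_lt_of_lt hUD hdisj (by omega) (hij.trans hjk)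
  constructor
  · intro hj
    have hp : pos n D U j ≤ D.card := by
      obtain ⟨-, h | h | h | h⟩ := pj
      exacts [absurd hj h.2.2.1, absurd hj h.2.2.1, h.2.2.2.2.2, absurd hj h.2.2.1]
    clear pj
    simp only [Cyc]
    omega
  · intro hj
    have hp : D.card + 2 ≤ pos n D U j := by
      obtain ⟨-, h | h | h | h⟩ := pj
      · omega
      · omega
      · exact absurd h.2.2.1 hj
      · exact h.2.2.2.2.1
    clear pj
    simp only [Cyc]
    omega

theorem Joined.third_eq (hUD : D ∪ U = Finset.Icc 1 (n + 1)) (hdisj : Disjoint D U)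
    (hT : IsTriangulation n D U T) {i j k i' k' : ℕ}
    (hjk : Joined n D U T j k) (hjk' : Joined n D U T j k') (hik : Joined n D U T k i)
    (hik' : Joined n D U T k' i')
    (h1 : Cyc (pos n D U j) (pos n D U k) (pos n D U i'))
    (h2 : Cyc (pos n D U j) (pos n D U k') (pos n D U i)) : k = k' := by
  by_contra hne
  have hp : pos n D U k ≠ pos n D U k' := fun e =>
    hne (pos_injective hUD hdisj (hjk.bounds hT).2.1 (hjk'.bounds hT).2.1 e)
  rcases cyc_or_cyc h1.ne.1 h2.ne.1 hp with h | h
  · have := h.trans_left h2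
    exact hik.not_cross hUD hdisj hT hjk'.symm ⟨this.2, this.1.rotate.rotate⟩
  · have := h.trans_left h1
    exact hik'.not_cross hUD hdisj hT hjk.symm ⟨this.2, this.1.rotate.rotate⟩

theorem Joined.third_eq' (hUD : D ∪ U = Finset.Icc 1 (n + 1)) (hdisj : Disjoint D U)
    (hT : IsTriangulation n D U T) {i j k i' k' : ℕ}
    (hij : Joined n D U T j i) (hij' : Joined n D U T j i') (hik : Joined n D U T k i)
    (hik' : Joined n D U T k' i')
    (h1 : Cyc (pos n D U j) (pos n D U k) (pos n D U i'))
    (h2 : Cyc (pos n D U j) (pos n D U k') (pos n D U i)) : i = i' := by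
  by_contra hne
  have hp : pos n D U i ≠ pos n D U i' := fun e =>
    hne (pos_injective hUD hdisj (hij.bounds hT).2.1 (hij'.bounds hT).2.1 e)
  rcases cyc_or_cyc h2.ne.2.2 h1.ne.2.2 hp with h | h
  · have := h2.trans_left h
    exact hik'.not_cross hUD hdisj hT hij.symm ⟨this.2, this.1.rotate.rotate⟩
  · have := h1.trans_left h
    exact hik.not_cross hUD hdisj hT hij'.symm ⟨this.2, this.1.rotate.rotate⟩

/-- A triangle is determined by its middle vertex. -/
theorem IsTriangleOf.unique (hUD : D ∪ U = Finset.Icc 1 (n + 1)) (hdisj : Disjoint D U)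
    (hT : IsTriangulation n D U T) {i j k i' k' : ℕ}
    (h : IsTriangleOf n D U T i j k) (h' : IsTriangleOf n D U T i' j k') : i = i' ∧ k = k' := by
  obtain ⟨hij, hjk, hk, eij, ejk, eik⟩ := h
  obtain ⟨hij', hjk', hk', eij', ejk', eik'⟩ := h'
  replace eij := eij.joined hT
  replace ejk := ejk.joined hT
  replace eik := eik.joined hT
  replace eij' := eij'.joined hT
  replace ejk' := ejk'.joined hT
  replace eik' := eik'.joined hT
  have c1 := cyc_of_lt_of_lt hUD hdisj hij' hjk hk
  have c2 := cyc_of_lt_of_lt hUD hdisj hij hjk' hk'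
  by_cases hj : j ∈ D
  · exact ⟨Joined.third_eq' hUD hdisj hT eij.symm eij'.symm eik.symm eik'.symm (c1.1 hj) (c2.1 hj),
      Joined.third_eq hUD hdisj hT ejk ejk' eik.symm eik'.symm (c1.1 hj) (c2.1 hj)⟩
  · exact ⟨Joined.third_eq hUD hdisj hT eij.symm eij'.symm eik eik' (c2.2 hj) (c1.2 hj),
      Joined.third_eq' hUD hdisj hT ejk ejk' eik eik' (c2.2 hj) (c1.2 hj)⟩

/-- The coordinate attached to the middle vertex of a triangle. -/
theorem IsTriangleOf.xcoord_eq (hUD : D ∪ U = Finset.Icc 1 (n + 1)) (hdisj : Disjoint D U)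
    (hT : IsTriangulation n D U T) {i j k : ℕ} (h : IsTriangleOf n D U T i j k) :
    xcoord n D U T j =
      if j ∈ D then ((bel n D U (i, j) : ℝ) + 1) * ((bel n D U (j, k) : ℝ) + 1)
      else ((n : ℝ) + 2) -
        (((n : ℝ) + 2) - (bel n D U (i, j) : ℝ)) * (((n : ℝ) + 2) - (bel n D U (j, k) : ℝ)) := by
  have hex : ∃ p : ℕ × ℕ, IsTriangleOf n D U T p.1 j p.2 := ⟨(i, k), h⟩
  obtain ⟨h1, h2⟩ := h.unique hUD hdisj hT hex.choose_spec
  rw [xcoord, dif_pos hex, ← h1, ← h2]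

end Triangulation

/-- The labels on the right of the oriented diagonal from `a` to `b`: it is `Bel (a, b)` when
`a < b` and `Abo (b, a)` when `b < a`. -/
def side (n : ℕ) (D U : Finset ℕ) (a b : ℕ) : Finset ℕ :=
  if a < b then Bel n D U (a, b) else Abo n D U (b, a)

section Side

variable {n : ℕ} {D U : Finset ℕ} {T : Finset (ℕ × ℕ)}

theorem side_of_lt {a b : ℕ} (h : a < b) : side n D U a b = Bel n D U (a, b) := if_pos h

theorem bel_eq_card_side {a b : ℕ} (h : a < b) :
    (bel n D U (a, b) : ℝ) = (side n D U a b).card := by rw [side_of_lt h, bel]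

theorem bel_add_card_side {a b : ℕ} (h : a < b) :
    (bel n D U (a, b) : ℝ) + (side n D U b a).card = (n : ℝ) + 1 := by
  rw [side, if_neg (by omega), bel, Abo]
  have h1 : Bel n D U (a, b) ⊆ Finset.Icc 1 (n + 1) := Finset.filter_subset _ _
  have h2 := Finset.card_sdiff_add_card_eq_card h1
  rw [Nat.card_Icc] at h2
  rw [add_comm]
  exact_mod_cast h2

theorem mem_Bel (hUD : D ∪ U = Finset.Icc 1 (n + 1)) (hdisj : Disjoint D U) {a b j : ℕ}
    (ha : a ≤ n + 2) (hb : b ≤ n + 2) :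
    j ∈ Bel n D U (a, b) ↔ (1 ≤ j ∧ j ≤ n + 1) ∧
      (Cyc (pos n D U a) (pos n D U j) (pos n D U b) ∨ ((j = a ∨ j = b) ∧ j ∉ D)) := by
  rw [Bel, Finset.mem_filter, Finset.mem_Icc]
  refine and_congr_right fun hj => ?_
  rw [strictBetween_iff hUD hdisj ha hb (by omega)]
  have h1 := mem_down_or_up hUD j
  have h2 := not_mem_down_and_up hdisj j
  tauto

theorem mem_side (hUD : D ∪ U = Finset.Icc 1 (n + 1)) (hdisj : Disjoint D U) {a b j : ℕ}
    (ha : a ≤ n + 2) (hb : b ≤ n + 2) (hne : a ≠ b) :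
    j ∈ side n D U a b ↔ (1 ≤ j ∧ j ≤ n + 1) ∧
      (Cyc (pos n D U a) (pos n D U j) (pos n D U b) ∨
        ((j = a ∨ j = b) ∧ (a < b ↔ j ∉ D))) := by
  rw [side]
  split_ifs with h
  · rw [mem_Bel hUD hdisj ha hb]
    simp only [h, true_iff]
  · rw [Abo, Finset.mem_sdiff, mem_Bel hUD hdisj hb ha, Finset.mem_Icc]
    simp only [h, false_iff, not_not]
    by_cases hj : 1 ≤ j ∧ j ≤ n + 1
    · simp only [hj, true_and, and_self]
      by_cases hja : j = a
      · subst hja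
        have := fun h : Cyc (pos n D U j) (pos n D U j) (pos n D U b) => h.ne.1 rfl
        have := fun h : Cyc (pos n D U b) (pos n D U j) (pos n D U j) => h.ne.2.1 rfl
        tauto
      by_cases hjb : j = b
      · subst hjb
        have := fun h : Cyc (pos n D U j) (pos n D U j) (pos n D U a) => h.ne.1 rfl
        have := fun h : Cyc (pos n D U a) (pos n D U j) (pos n D U j) => h.ne.2.1 rfl
        tauto
      have h1 : pos n D U j ≠ pos n D U a := fun e =>
        hja (pos_injective hUD hdisj (by omega) ha e)
      have h2 : pos n D U j ≠ pos n D U b := fun e =>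
        hjb (pos_injective hUD hdisj (by omega) hb e)
      have h3 : pos n D U a ≠ pos n D U b := fun e =>
        hne (pos_injective hUD hdisj ha hb e)
      simp only [hja, hjb, or_self, false_and, or_false, Cyc]
      omega
    · tauto

/-- The labels on the right of the edge `(a, b)` of a triangle `(a, c, b)`: the label of the
triangle and the labels on the right of its two other edges. -/
theorem mem_side_triple (hUD : D ∪ U = Finset.Icc 1 (n + 1)) (hdisj : Disjoint D U)
    {a b c m : ℕ} (ha : a ≤ n + 2) (hb : b ≤ n + 2) (hc : c ≤ n + 2)
    (h : Cyc (pos n D U a) (pos n D U c) (pos n D U b))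
    (hm : (a < b ∧ ((m = c ∧ a < c ∧ c < b ∧ m ∈ D) ∨ (m = a ∧ c < a ∧ m ∉ D) ∨
      (m = b ∧ b < c ∧ m ∉ D))) ∨
      (b < a ∧ ((m = c ∧ b < c ∧ c < a ∧ m ∉ D) ∨ (m = a ∧ a < c ∧ m ∈ D) ∨
      (m = b ∧ c < b ∧ m ∈ D)))) (j : ℕ) :
    (j ∈ side n D U a b ↔ j = m ∨ j ∈ side n D U a c ∨ j ∈ side n D U c b) ∧
    ¬ (j = m ∧ (j ∈ side n D U a c ∨ j ∈ side n D U c b)) ∧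
    ¬ (j ∈ side n D U a c ∧ j ∈ side n D U c b) := by
  have hmb : 1 ≤ m ∧ m ≤ n + 1 := by omega
  have hab : a ≠ b := by rintro rfl; exact h.ne.2.2 rfl
  have hac : a ≠ c := by rintro rfl; exact h.ne.1 rfl
  have hcb : c ≠ b := by rintro rfl; exact h.ne.2.1 rfl
  rw [mem_side hUD hdisj ha hb hab, mem_side hUD hdisj ha hc hac, mem_side hUD hdisj hc hb hcb]
  by_cases hj : 1 ≤ j ∧ j ≤ n + 1
  swap
  · have : j ≠ m := by rintro rfl; exact hj hmb
    tauto
  simp only [hj, true_and, and_self]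
  by_cases hja : j = a
  · subst hja
    have e1 : ¬ Cyc (pos n D U j) (pos n D U j) (pos n D U b) := fun h => h.ne.1 rfl
    have e2 : ¬ Cyc (pos n D U j) (pos n D U j) (pos n D U c) := fun h => h.ne.1 rfl
    have e3 : ¬ Cyc (pos n D U c) (pos n D U j) (pos n D U b) := by
      simp only [Cyc] at *
      omega
    simp only [e1, e2, e3, hab, hac, false_or, true_and, or_false, false_and]
    grind
  by_cases hjb : j = b
  · subst hjb
    have e1 : ¬ Cyc (pos n D U a) (pos n D U j) (pos n D U j) := fun h => h.ne.2.1 rfl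
    have e2 : ¬ Cyc (pos n D U c) (pos n D U j) (pos n D U j) := fun h => h.ne.2.1 rfl
    have e3 : ¬ Cyc (pos n D U a) (pos n D U j) (pos n D U c) := by
      simp only [Cyc] at *
      omega
    simp only [e1, e2, e3, hja, hcb.symm, false_or, or_true, true_and, or_false, false_and]
    grind
  by_cases hjc : j = c
  · subst hjc
    have e1 : ¬ Cyc (pos n D U a) (pos n D U j) (pos n D U j) := fun h => h.ne.2.1 rfl
    have e2 : ¬ Cyc (pos n D U j) (pos n D U j) (pos n D U b) := fun h => h.ne.1 rfl
    simp only [e1, e2, h, hja, hjb, false_or, or_true, true_and, or_false, true_or, true_iff]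
    grind
  have h1 : pos n D U j ≠ pos n D U a := fun e => hja (pos_injective hUD hdisj (by omega) ha e)
  have h2 : pos n D U j ≠ pos n D U b := fun e => hjb (pos_injective hUD hdisj (by omega) hb e)
  have h3 : pos n D U j ≠ pos n D U c := fun e => hjc (pos_injective hUD hdisj (by omega) hc e)
  have hjm : j ≠ m := by omega
  simp only [hja, hjb, hjc, hjm, or_self, false_and, or_false, false_or, not_false_eq_true,
    true_and]
  exact h.split_iff h3

theorem sum_side_triple (hUD : D ∪ U = Finset.Icc 1 (n + 1)) (hdisj : Disjoint D U)
    {a b c m : ℕ} (ha : a ≤ n + 2) (hb : b ≤ n + 2) (hc : c ≤ n + 2)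
    (h : Cyc (pos n D U a) (pos n D U c) (pos n D U b))
    (hm : (a < b ∧ ((m = c ∧ a < c ∧ c < b ∧ m ∈ D) ∨ (m = a ∧ c < a ∧ m ∉ D) ∨
      (m = b ∧ b < c ∧ m ∉ D))) ∨
      (b < a ∧ ((m = c ∧ b < c ∧ c < a ∧ m ∉ D) ∨ (m = a ∧ a < c ∧ m ∈ D) ∨
      (m = b ∧ c < b ∧ m ∈ D)))) (f : ℕ → ℝ) :
    ∑ j ∈ side n D U a b, f j =
      f m + ∑ j ∈ side n D U a c, f j + ∑ j ∈ side n D U c b, f j := by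
  have key := mem_side_triple hUD hdisj ha hb hc h hm
  have e : side n D U a b = insert m (side n D U a c ∪ side n D U c b) := by
    ext j
    simpa using (key j).1
  rw [e, Finset.sum_insert, Finset.sum_union, add_assoc]
  · exact Finset.disjoint_left.2 fun j h1 h2 => (key j).2.2 ⟨h1, h2⟩
  · intro hmem
    exact (key m).2.1 ⟨rfl, by simpa using hmem⟩

/-- The expected value of the sum of the coordinates on the right of an edge. -/
def SideSum (n : ℕ) (D U : Finset ℕ) (T : Finset (ℕ × ℕ)) (a b : ℕ) : Prop :=
  (a < b → ∑ j ∈ side n D U a b, xcoord n D U T j =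
    ((side n D U a b).card : ℝ) * ((side n D U a b).card + 1) / 2) ∧
  (b < a → ∑ j ∈ side n D U a b, xcoord n D U T j = ((n : ℝ) + 2) * (side n D U a b).card -
    ((side n D U a b).card : ℝ) * ((side n D U a b).card + 1) / 2)

theorem SideSum.triple (hUD : D ∪ U = Finset.Icc 1 (n + 1)) (hdisj : Disjoint D U)
    (hT : IsTriangulation n D U T) {a b c : ℕ}
    (h : Cyc (pos n D U a) (pos n D U c) (pos n D U b))
    (jab : Joined n D U T a b) (jac : Joined n D U T a c) (jcb : Joined n D U T c b)
    (sac : SideSum n D U T a c) (scb : SideSum n D U T c b) : SideSum n D U T a b := by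
  obtain ⟨ha, hb, hab⟩ := jab.bounds hT
  obtain ⟨-, hc, hac⟩ := jac.bounds hT
  obtain ⟨-, -, hcb⟩ := jcb.bounds hT
  have key : ∀ m, ((a < b ∧ ((m = c ∧ a < c ∧ c < b ∧ m ∈ D) ∨ (m = a ∧ c < a ∧ m ∉ D) ∨
      (m = b ∧ b < c ∧ m ∉ D))) ∨
      (b < a ∧ ((m = c ∧ b < c ∧ c < a ∧ m ∉ D) ∨ (m = a ∧ a < c ∧ m ∈ D) ∨
      (m = b ∧ c < b ∧ m ∈ D)))) →
      (∑ j ∈ side n D U a b, xcoord n D U T j = xcoord n D U T m +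
        ∑ j ∈ side n D U a c, xcoord n D U T j + ∑ j ∈ side n D U c b, xcoord n D U T j) ∧
      ((side n D U a b).card : ℝ) = 1 + (side n D U a c).card + (side n D U c b).card := by
    intro m hm
    refine ⟨sum_side_triple hUD hdisj ha hb hc h hm _, ?_⟩
    simpa using sum_side_triple hUD hdisj ha hb hc h hm (fun _ => 1)
  have hrev : ¬ Cyc (pos n D U a) (pos n D U b) (pos n D U c) := by
    simp only [Cyc] at *
    omega
  rcases lt_or_gt_of_ne hab with lab | lab
  · refine ⟨fun _ => ?_, fun h => by omega⟩
    rcases lt_or_gt_of_ne hac with lac | lac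
    · rcases lt_or_gt_of_ne hcb with lcb | lcb
      · have hD : c ∈ D := by
          by_contra hD
          exact hrev ((cyc_of_lt_of_lt hUD hdisj lac lcb hb).2 hD).rotate
        obtain ⟨e1, e2⟩ := key c (Or.inl ⟨lab, Or.inl ⟨rfl, lac, lcb, hD⟩⟩)
        have hx := IsTriangleOf.xcoord_eq hUD hdisj hT
          ⟨lac, lcb, hb, jac.edgeOf_of_lt lac, jcb.edgeOf_of_lt lcb, jab.edgeOf_of_lt lab⟩
        rw [if_pos hD, bel_eq_card_side lac, bel_eq_card_side lcb] at hx
        rw [e1, hx, sac.1 lac, scb.1 lcb, e2]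
        ring
      · have hD : b ∉ D := fun hD =>
          hrev ((cyc_of_lt_of_lt hUD hdisj lab lcb hc).1 hD).rotate.rotate
        obtain ⟨e1, e2⟩ := key b (Or.inl ⟨lab, Or.inr (Or.inr ⟨rfl, lcb, hD⟩)⟩)
        have hx := IsTriangleOf.xcoord_eq hUD hdisj hT
          ⟨lab, lcb, hc, jab.edgeOf_of_lt lab, jcb.symm.edgeOf_of_lt lcb, jac.edgeOf_of_lt lac⟩
        have hb := bel_add_card_side (n := n) (D := D) (U := U) lcb
        rw [if_neg hD, bel_eq_card_side lab, eq_sub_of_add_eq hb] at hx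
        rw [e1, hx, sac.1 lac, scb.2 lcb, e2]
        ring
    · have hD : a ∉ D := fun hD => hrev ((cyc_of_lt_of_lt hUD hdisj lac lab hb).1 hD)
      have lcb : c < b := by omega
      obtain ⟨e1, e2⟩ := key a (Or.inl ⟨lab, Or.inr (Or.inl ⟨rfl, lac, hD⟩)⟩)
      have hx := IsTriangleOf.xcoord_eq hUD hdisj hT
        ⟨lac, lab, hb, jac.symm.edgeOf_of_lt lac, jab.edgeOf_of_lt lab, jcb.edgeOf_of_lt lcb⟩
      have hb := bel_add_card_side (n := n) (D := D) (U := U) lac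
      rw [if_neg hD, bel_eq_card_side lab, eq_sub_of_add_eq hb] at hx
      rw [e1, hx, sac.2 lac, scb.1 lcb, e2]
      ring
  · refine ⟨fun h => by omega, fun _ => ?_⟩
    have hbab := bel_add_card_side (n := n) (D := D) (U := U) lab
    rcases lt_or_gt_of_ne hac with lac | lac
    · have lcb : b < c := by omega
      have hD : a ∈ D := by
        by_contra hD
        exact hrev ((cyc_of_lt_of_lt hUD hdisj lab lac hc).2 hD)
      obtain ⟨e1, e2⟩ := key a (Or.inr ⟨lab, Or.inr (Or.inl ⟨rfl, lac, hD⟩)⟩)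
      have hx := IsTriangleOf.xcoord_eq hUD hdisj hT
        ⟨lab, lac, hc, jab.symm.edgeOf_of_lt lab, jac.edgeOf_of_lt lac, jcb.symm.edgeOf_of_lt lcb⟩
      rw [if_pos hD, bel_eq_card_side lac, eq_sub_of_add_eq hbab] at hx
      rw [e1, hx, sac.1 lac, scb.2 lcb, e2]
      ring
    · rcases lt_or_gt_of_ne hcb with lcb | lcb
      · have hD : b ∈ D := by
          by_contra hD
          exact hrev ((cyc_of_lt_of_lt hUD hdisj lcb lab ha).2 hD).rotate.rotate
        obtain ⟨e1, e2⟩ := key b (Or.inr ⟨lab, Or.inr (Or.inr ⟨rfl, lcb, hD⟩)⟩)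
        have hx := IsTriangleOf.xcoord_eq hUD hdisj hT
          ⟨lcb, lab, ha, jcb.edgeOf_of_lt lcb, jab.symm.edgeOf_of_lt lab, jac.symm.edgeOf_of_lt lac⟩
        rw [if_pos hD, bel_eq_card_side lcb, eq_sub_of_add_eq hbab] at hx
        rw [e1, hx, sac.2 lac, scb.1 lcb, e2]
        ring
      · have hD : c ∉ D := fun hD =>
          hrev ((cyc_of_lt_of_lt hUD hdisj lcb lac ha).1 hD).rotate
        obtain ⟨e1, e2⟩ := key c (Or.inr ⟨lab, Or.inl ⟨rfl, lcb, lac, hD⟩⟩)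
        have hx := IsTriangleOf.xcoord_eq hUD hdisj hT
          ⟨lcb, lac, ha, jcb.symm.edgeOf_of_lt lcb, jac.symm.edgeOf_of_lt lac,
            jab.symm.edgeOf_of_lt lab⟩
        have h1 := bel_add_card_side (n := n) (D := D) (U := U) lcb
        have h2 := bel_add_card_side (n := n) (D := D) (U := U) lac
        rw [if_neg hD, eq_sub_of_add_eq h1, eq_sub_of_add_eq h2] at hx
        rw [e1, hx, sac.2 lac, scb.2 lcb, e2]
        ring

theorem side_eq_empty (hUD : D ∪ U = Finset.Icc 1 (n + 1)) (hdisj : Disjoint D U)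
    {a b : ℕ} (ha : a ≤ n + 2) (hb : b ≤ n + 2) (hne : a ≠ b) (h : relpos n D U a b = 1) :
    side n D U a b = ∅ := by
  rw [Finset.eq_empty_iff_forall_notMem]
  intro j hj
  rw [mem_side hUD hdisj ha hb hne] at hj
  obtain ⟨hj, hj' | ⟨hj', hj''⟩⟩ := hj
  · have := ((strictBetween_iff hUD hdisj ha hb (by omega)).2 hj').2
    omega
  have r := relpos_spec hUD hdisj ha hb
  have pa := pos_spec hUD hdisj ha
  have pb := pos_spec hUD hdisj hb
  rcases lt_or_gt_of_ne hne with hlt | hlt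
  · have o := pos_lt_of_lt hUD hdisj hb hlt
    have hjD : j ∉ D := hj''.1 hlt
    rcases hj' with rfl | rfl
    · obtain ⟨-, pa | pa | pa | pa⟩ := pa
      · omega
      · omega
      · exact hjD pa.2.2.1
      · omega
    · obtain ⟨-, pb | pb | pb | pb⟩ := pb
      · omega
      · omega
      · exact hjD pb.2.2.1
      · omega
  · have o := pos_lt_of_lt hUD hdisj ha hlt
    have hjD : j ∈ D := by
      by_contra hjD
      have := hj''.2 hjD
      omega
    rcases hj' with rfl | rfl
    · obtain ⟨-, pa | pa | pa | pa⟩ := pa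
      · omega
      · omega
      · omega
      · exact pa.2.2.1 hjD
    · obtain ⟨-, pb | pb | pb | pb⟩ := pb
      · omega
      · omega
      · omega
      · exact pb.2.2.1 hjD

theorem Joined.sideSum (hUD : D ∪ U = Finset.Icc 1 (n + 1)) (hdisj : Disjoint D U)
    (hT : IsTriangulation n D U T) {a b : ℕ} (h : Joined n D U T a b) :
    SideSum n D U T a b := by
  induction hr : relpos n D U a b using Nat.strong_induction_on generalizing a b with
  | _ r ih =>
    subst hr
    obtain ⟨ha, hb, hne⟩ := h.bounds hT
    by_cases h1 : relpos n D U a b = 1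
    · have := side_eq_empty hUD hdisj ha hb hne h1
      constructor <;> simp [this]
    · obtain ⟨c, hc, hcyc, hac, hcb⟩ := h.exists_third hUD hdisj hT h1
      have hlt := ((strictBetween_iff hUD hdisj ha hb hc).2 hcyc).2.2
      have hlt' : relpos n D U c b < relpos n D U a b := by
        have r1 := relpos_spec hUD hdisj ha hb
        have r2 := relpos_spec hUD hdisj hc hb
        have := pos_le hUD hdisj ha
        simp only [Cyc] at hcyc
        omega
      exact SideSum.triple hUD hdisj hT hcyc h hac hcb (ih _ hlt hac rfl) (ih _ hlt' hcb rfl)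

/-- The edges of a triangulation satisfy the equality. -/
theorem EdgeOf.sum_Bel_eq (hUD : D ∪ U = Finset.Icc 1 (n + 1)) (hdisj : Disjoint D U)
    (hT : IsTriangulation n D U T) {a b : ℕ} (h : EdgeOf n D U T a b) :
    ∑ j ∈ Bel n D U (a, b), xcoord n D U T j =
      ((bel n D U (a, b) : ℝ) + 1) * (bel n D U (a, b) : ℝ) / 2 := by
  have hab := (h.bounds hT).1
  have := ((h.joined hT).sideSum hUD hdisj hT).1 hab
  rw [side_of_lt hab] at this
  rw [this, bel]
  ring

end Side

section Gap

variable {n : ℕ} {D U : Finset ℕ} {T : Finset (ℕ × ℕ)}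

/-- Two crossing diagonals oriented left to right: the left endpoint of the one lies left of the
right endpoint of the other. -/
theorem lt_of_crossing (hUD : D ∪ U = Finset.Icc 1 (n + 1)) (hdisj : Disjoint D U)
    {a b c d : ℕ} (hab : a < b) (hb : b ≤ n + 2) (hcd : c < d) (hd : d ≤ n + 2)
    (h1 : Cyc (pos n D U a) (pos n D U c) (pos n D U b))
    (h2 : Cyc (pos n D U b) (pos n D U d) (pos n D U a)) : c < b ∧ a < d := by
  have hcb : c ≠ b := by rintro rfl; exact h1.ne.2.1 rfl
  have had : a ≠ d := by rintro rfl; exact h2.ne.2.1 rfl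
  constructor
  · by_contra hlt
    have hbc : b < c := by omega
    have k1 := cyc_of_lt_of_lt hUD hdisj hab hbc (by omega)
    have k3 := cyc_of_lt_of_lt hUD hdisj hab (hbc.trans hcd) hd
    by_cases hbD : b ∈ D
    · have := k1.1 hbD
      simp only [Cyc] at this h1
      omega
    · have := k3.2 hbD
      simp only [Cyc] at this h2
      omega
  · by_contra hlt
    have hda : d < a := by omega
    have k2 := cyc_of_lt_of_lt hUD hdisj hda hab hb
    have k3 := cyc_of_lt_of_lt hUD hdisj (hcd.trans hda) hab hb
    by_cases haD : a ∈ D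
    · have := k3.1 haD
      simp only [Cyc] at this h1
      omega
    · have := k2.2 haD
      simp only [Cyc] at this h2
      omega

theorem Cyc.inter_union_iff {a b c d j : ℕ} (h1 : Cyc a c b) (h2 : Cyc b d a)
    (hb : j ≠ b) (hc : j ≠ c) :
    (Cyc a j b ∧ Cyc c j d ↔ Cyc c j b) ∧ (Cyc a j b ∨ Cyc c j d ↔ Cyc a j d) := by
  have h3 : Cyc a b d := h2.rotate.rotate
  have h4 : Cyc c b d := (h1.trans_left h3).2
  have h5 := h3.split_iff hb
  have h6 := h1.split_iff hc
  have h7 := h4.split_iff hb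
  constructor
  · refine ⟨fun ⟨h, h'⟩ => ?_, fun h => ⟨h6.1.2 (Or.inr h), h7.1.2 (Or.inl h)⟩⟩
    exact (h7.1.1 h').resolve_right fun h'' => h5.2 ⟨h, h''⟩
  · refine ⟨?_, fun h => (h5.1.1 h).imp id fun h' => h7.1.2 (Or.inr h')⟩
    rintro (h | h)
    · exact h5.1.2 (Or.inl h)
    · exact h5.1.2 ((h7.1.1 h).imp (fun h' => h6.1.2 (Or.inr h')) id)

theorem Bel_inter_union (hUD : D ∪ U = Finset.Icc 1 (n + 1)) (hdisj : Disjoint D U)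
    {a b c d : ℕ} (ha : a ≤ n + 2) (hb : b ≤ n + 2) (hc : c ≤ n + 2) (hd : d ≤ n + 2)
    (h1 : Cyc (pos n D U a) (pos n D U c) (pos n D U b))
    (h2 : Cyc (pos n D U b) (pos n D U d) (pos n D U a)) :
    Bel n D U (a, b) ∩ Bel n D U (c, d) = Bel n D U (c, b) ∧
    Bel n D U (a, b) ∪ Bel n D U (c, d) = Bel n D U (a, d) := by
  suffices ∀ j, (j ∈ Bel n D U (a, b) ∧ j ∈ Bel n D U (c, d) ↔ j ∈ Bel n D U (c, b)) ∧
      (j ∈ Bel n D U (a, b) ∨ j ∈ Bel n D U (c, d) ↔ j ∈ Bel n D U (a, d)) by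
    constructor <;> ext j
    · simpa using (this j).1
    · simpa using (this j).2
  intro j
  rw [mem_Bel hUD hdisj ha hb, mem_Bel hUD hdisj hc hd, mem_Bel hUD hdisj hc hb,
    mem_Bel hUD hdisj ha hd]
  by_cases hj : 1 ≤ j ∧ j ≤ n + 1
  swap
  · simp only [hj, false_and, and_self, or_self]
  simp only [hj, true_and, and_self]
  have h3 : Cyc (pos n D U a) (pos n D U b) (pos n D U d) := h2.rotate.rotate
  have h4 := (h1.trans_left h3)
  have hab : a ≠ b := by rintro rfl; exact h1.ne.2.2 rfl
  have hac : a ≠ c := by rintro rfl; exact h1.ne.1 rfl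
  have had : a ≠ d := by rintro rfl; exact h2.ne.2.1 rfl
  have hbc : b ≠ c := by rintro rfl; exact h1.ne.2.1 rfl
  have hbd : b ≠ d := by rintro rfl; exact h2.ne.1 rfl
  have hcd : c ≠ d := by rintro rfl; exact h4.1.ne.2.1 rfl
  have irr1 : ∀ x y, ¬ Cyc x x y := fun x y h => h.ne.1 rfl
  have irr2 : ∀ x y, ¬ Cyc x y y := fun x y h => h.ne.2.1 rfl
  have asymm : ∀ x y z, Cyc x y z → ¬ Cyc x z y := by
    intro x y z h
    simp only [Cyc] at *
    omega
  by_cases hja : j = a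
  · subst hja
    have := asymm _ _ _ h4.1.rotate.rotate
    have h5 := asymm _ _ _ h1.rotate
    simp only [irr1, h5, hab, hac, had, false_or, or_false, true_and, false_and]
    have h6 : ¬ Cyc (pos n D U c) (pos n D U j) (pos n D U d) :=
      fun h => asymm _ _ _ h4.1.rotate h
    simp only [h6]
    tauto
  by_cases hjb : j = b
  · subst hjb
    simp only [irr2, h3, h4.2, hab.symm, hbc, hbd, false_or, or_false, or_true, true_and,
      and_true, true_or]
  by_cases hjc : j = c
  · subst hjc
    simp only [irr1, h1, h4.1, hac.symm, hbc.symm, hcd, false_or, or_false, true_and, true_or]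
  by_cases hjd : j = d
  · subst hjd
    have h5 : ¬ Cyc (pos n D U a) (pos n D U j) (pos n D U b) := asymm _ _ _ h3
    have h6 : ¬ Cyc (pos n D U c) (pos n D U j) (pos n D U b) := asymm _ _ _ h4.2
    simp only [irr2, h5, h6, had.symm, hbd.symm, hcd.symm, false_or, or_false, or_true, true_and,
      false_and]
  have e2 : pos n D U j ≠ pos n D U b := fun e => hjb (pos_injective hUD hdisj (by omega) hb e)
  have e3 : pos n D U j ≠ pos n D U c := fun e => hjc (pos_injective hUD hdisj (by omega) hc e)
  simp only [hja, hjb, hjc, hjd, or_self, false_and, or_false]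
  exact h1.inter_union_iff h2 e2 e3

theorem Bel_inter_card_lt (hUD : D ∪ U = Finset.Icc 1 (n + 1)) (hdisj : Disjoint D U)
    {a b c d : ℕ} (hab : a < b) (hb : b ≤ n + 2) (hcd : c < d) (hd : d ≤ n + 2)
    (h1 : Cyc (pos n D U a) (pos n D U c) (pos n D U b))
    (h2 : Cyc (pos n D U b) (pos n D U d) (pos n D U a)) :
    bel n D U (c, b) < bel n D U (a, b) ∧ bel n D U (c, b) < bel n D U (c, d) := by
  have ha : a ≤ n + 2 := by omega
  have hc : c ≤ n + 2 := by omega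
  obtain ⟨hcb, had⟩ := lt_of_crossing hUD hdisj hab hb hcd hd h1 h2
  have hI := (Bel_inter_union hUD hdisj ha hb hc hd h1 h2).1
  have hac : a ≠ c := by rintro rfl; exact h1.ne.1 rfl
  have hbd : b ≠ d := by rintro rfl; exact h2.ne.1 rfl
  have irr1 : ∀ x y, ¬ Cyc x x y := fun x y h => h.ne.1 rfl
  have irr2 : ∀ x y, ¬ Cyc x y y := fun x y h => h.ne.2.1 rfl
  have h3 : Cyc (pos n D U a) (pos n D U b) (pos n D U d) := h2.rotate.rotate
  have h4 := (h1.trans_left h3)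
  have asymm : ∀ x y z, Cyc x y z → ¬ Cyc x z y := by
    intro x y z h
    simp only [Cyc] at *
    omega
  constructor <;> refine Finset.card_lt_card ((Finset.ssubset_iff_of_subset ?_).2 ?_)
  · rw [← hI]; exact Finset.inter_subset_left
  · simp only [mem_Bel hUD hdisj ha hb, mem_Bel hUD hdisj hc hb]
    rcases lt_or_gt_of_ne hac with hlt | hlt
    · have hcD : c ∈ D := by
        by_contra hcD
        have := (cyc_of_lt_of_lt hUD hdisj hlt hcb hb).2 hcD
        exact asymm _ _ _ h1 this.rotate
      refine ⟨c, ⟨by omega, Or.inl h1⟩, ?_⟩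
      simp [irr1, hcD]
    · have haD : a ∉ D := fun haD =>
        asymm _ _ _ h1 ((cyc_of_lt_of_lt hUD hdisj hlt hab hb).1 haD)
      refine ⟨a, ⟨by omega, Or.inr ⟨Or.inl rfl, haD⟩⟩, ?_⟩
      rintro ⟨-, h | ⟨h, -⟩⟩
      · exact asymm _ _ _ h1.rotate h
      · omega
  · rw [← hI]; exact Finset.inter_subset_right
  · simp only [mem_Bel hUD hdisj hc hd, mem_Bel hUD hdisj hc hb]
    rcases lt_or_gt_of_ne hbd with hlt | hlt
    · have hbD : b ∈ D := by
        by_contra hbD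
        have := (cyc_of_lt_of_lt hUD hdisj hab hlt hd).2 hbD
        exact asymm _ _ _ h2 this
      refine ⟨b, ⟨by omega, Or.inl h4.2⟩, ?_⟩
      simp [irr2, hbD]
    · have hdD : d ∉ D := fun hdD =>
        asymm _ _ _ h2 ((cyc_of_lt_of_lt hUD hdisj had hlt hb).1 hdD).rotate
      refine ⟨d, ⟨by omega, Or.inr ⟨Or.inr rfl, hdD⟩⟩, ?_⟩
      rintro ⟨-, h | ⟨h, -⟩⟩
      · exact asymm _ _ _ h4.2 h
      · omega

/-- The amount by which the sum of the coordinates over `Bel δ` exceeds its value for edges. -/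
def gap (n : ℕ) (D U : Finset ℕ) (T : Finset (ℕ × ℕ)) (δ : ℕ × ℕ) : ℝ :=
  ∑ j ∈ Bel n D U δ, xcoord n D U T j - ((bel n D U δ : ℝ) + 1) * (bel n D U δ : ℝ) / 2

/-- Strict submodularity of the gap along a crossing. -/
theorem gap_add_gap_lt (hUD : D ∪ U = Finset.Icc 1 (n + 1)) (hdisj : Disjoint D U)
    {a b c d : ℕ} (hab : a < b) (hb : b ≤ n + 2) (hcd : c < d) (hd : d ≤ n + 2)
    (h1 : Cyc (pos n D U a) (pos n D U c) (pos n D U b))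
    (h2 : Cyc (pos n D U b) (pos n D U d) (pos n D U a)) :
    gap n D U T (c, b) + gap n D U T (a, d) < gap n D U T (a, b) + gap n D U T (c, d) := by
  obtain ⟨hI, hU⟩ := Bel_inter_union hUD hdisj (by omega) hb (by omega) hd h1 h2
  obtain ⟨l1, l2⟩ := Bel_inter_card_lt hUD hdisj hab hb hcd hd h1 h2
  have hs := Finset.sum_union_inter (s₁ := Bel n D U (a, b)) (s₂ := Bel n D U (c, d))
    (f := xcoord n D U T)
  have hcard := Finset.card_union_add_card_inter (Bel n D U (a, b)) (Bel n D U (c, d))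
  rw [hI, hU] at hs hcard
  change bel n D U (a, d) + bel n D U (c, b) = bel n D U (a, b) + bel n D U (c, d) at hcard
  rw [gap, gap, gap, gap]
  have lt_left : (bel n D U (c, b) : ℝ) < bel n D U (a, b) := by exact_mod_cast l1
  have lt_right : (bel n D U (c, b) : ℝ) < bel n D U (c, d) := by exact_mod_cast l2
  have hcard' : (bel n D U (a, d) : ℝ) = bel n D U (a, b) + bel n D U (c, d) - bel n D U (c, b) :=
    eq_sub_of_add_eq (by exact_mod_cast hcard)
  rw [hcard']
  nlinarith [mul_pos (sub_pos.2 lt_left) (sub_pos.2 lt_right)]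

/-- The diagonals of `T` crossing `δ`. -/
def crossing (n : ℕ) (D U : Finset ℕ) (T : Finset (ℕ × ℕ)) (δ : ℕ × ℕ) : Finset (ℕ × ℕ) :=
  T.filter (fun e => Cross n D U δ e)

theorem Cyc.subarc {a b c d e f : ℕ} (h1 : Cyc a c b) (h2 : Cyc b d a) (he : Cyc c e b)
    (hf : Cyc b f c) (h : ¬ (Cyc c e d ∧ Cyc d f c)) : Cyc a e b ∧ Cyc b f a := by
  have h3 := (h1.trans_left h2.rotate.rotate).2
  have h4 := (he.trans_left h3).1
  refine ⟨(h1.trans_right he).1, ?_⟩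
  by_contra hfa
  have hdf : ¬ Cyc d f c := fun h' => h ⟨h4, h'⟩
  clear h h3 h4 he
  simp only [Cyc] at *
  omega

theorem crossing_card_lt (hUD : D ∪ U = Finset.Icc 1 (n + 1)) (hdisj : Disjoint D U)
    (hT : IsTriangulation n D U T) {a b c d : ℕ} (ha : a ≤ n + 2) (hb : b ≤ n + 2)
    (hcd : Joined n D U T c d) (hmem : ∃ e ∈ T, e = (c, d) ∨ e = (d, c))
    (h1 : Cyc (pos n D U a) (pos n D U c) (pos n D U b))
    (h2 : Cyc (pos n D U b) (pos n D U d) (pos n D U a)) :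
    (crossing n D U T (c, b)).card < (crossing n D U T (a, b)).card := by
  obtain ⟨hc, hd, -⟩ := hcd.bounds hT
  refine Finset.card_lt_card ((Finset.ssubset_iff_of_subset ?_).2 ?_)
  · rintro ⟨e, f⟩ hef
    rw [crossing, Finset.mem_filter] at hef ⊢
    obtain ⟨hefT, hef⟩ := hef
    have hj : Joined n D U T e f := EdgeOf.joined hT (Or.inl hefT)
    obtain ⟨he, hf, -⟩ := hj.bounds hT
    rw [cross_iff hUD hdisj hc hb he hf] at hef
    rw [cross_iff hUD hdisj ha hb he hf]
    refine ⟨hefT, hef.imp ?_ ?_⟩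
    · rintro ⟨k1, k2⟩
      exact h1.subarc h2 k1 k2 (hcd.not_cross hUD hdisj hT hj)
    · rintro ⟨k1, k2⟩
      exact h1.subarc h2 k1 k2 (hcd.not_cross hUD hdisj hT hj.symm)
  · obtain ⟨e, heT, he⟩ := hmem
    refine ⟨e, ?_, ?_⟩
    · rw [crossing, Finset.mem_filter]
      refine ⟨heT, ?_⟩
      rcases he with rfl | rfl
      · exact (cross_iff hUD hdisj ha hb hc hd).2 (Or.inl ⟨h1, h2⟩)
      · exact (cross_iff hUD hdisj ha hb hd hc).2 (Or.inr ⟨h1, h2⟩)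
    · rw [crossing, Finset.mem_filter]
      rintro ⟨-, h⟩
      rcases he with rfl | rfl
      · exact h.2.2.1 rfl
      · exact h.2.2.2.1 rfl

theorem Cyc.subarc' {a b c d e f : ℕ} (h1 : Cyc a c b) (h2 : Cyc b d a) (he : Cyc a e c)
    (hf : Cyc c f a) (h : ¬ (Cyc d e c ∧ Cyc c f d)) : Cyc a e b ∧ Cyc b f a := by
  have h3 : Cyc a e b := (he.trans_left h1).1
  have h4 : Cyc d e c := by
    simp only [Cyc] at *
    omega
  have h5 : ¬ Cyc c f d := fun h' => h ⟨h4, h'⟩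
  refine ⟨h3, ?_⟩
  clear h h3 h4 he
  simp only [Cyc] at *
  omega

theorem crossing_card_lt' (hUD : D ∪ U = Finset.Icc 1 (n + 1)) (hdisj : Disjoint D U)
    (hT : IsTriangulation n D U T) {a b c d : ℕ} (ha : a ≤ n + 2) (hb : b ≤ n + 2)
    (hcd : Joined n D U T c d) (hmem : ∃ e ∈ T, e = (c, d) ∨ e = (d, c))
    (h1 : Cyc (pos n D U a) (pos n D U c) (pos n D U b))
    (h2 : Cyc (pos n D U b) (pos n D U d) (pos n D U a)) :
    (crossing n D U T (a, c)).card < (crossing n D U T (a, b)).card := by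
  obtain ⟨hc, hd, -⟩ := hcd.bounds hT
  refine Finset.card_lt_card ((Finset.ssubset_iff_of_subset ?_).2 ?_)
  · rintro ⟨e, f⟩ hef
    rw [crossing, Finset.mem_filter] at hef ⊢
    obtain ⟨hefT, hef⟩ := hef
    have hj : Joined n D U T e f := EdgeOf.joined hT (Or.inl hefT)
    obtain ⟨he, hf, -⟩ := hj.bounds hT
    rw [cross_iff hUD hdisj ha hc he hf] at hef
    rw [cross_iff hUD hdisj ha hb he hf]
    refine ⟨hefT, hef.imp ?_ ?_⟩
    · rintro ⟨k1, k2⟩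
      exact h1.subarc' h2 k1 k2 (hcd.symm.not_cross hUD hdisj hT hj)
    · rintro ⟨k1, k2⟩
      exact h1.subarc' h2 k1 k2 (hcd.symm.not_cross hUD hdisj hT hj.symm)
  · obtain ⟨e, heT, he⟩ := hmem
    refine ⟨e, ?_, ?_⟩
    · rw [crossing, Finset.mem_filter]
      refine ⟨heT, ?_⟩
      rcases he with rfl | rfl
      · exact (cross_iff hUD hdisj ha hb hc hd).2 (Or.inl ⟨h1, h2⟩)
      · exact (cross_iff hUD hdisj ha hb hd hc).2 (Or.inr ⟨h1, h2⟩)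
    · rw [crossing, Finset.mem_filter]
      rintro ⟨-, h⟩
      rcases he with rfl | rfl
      · exact h.2.2.2.2.1 rfl
      · exact h.2.2.2.2.2.1 rfl

theorem crossing_swap (hUD : D ∪ U = Finset.Icc 1 (n + 1)) (hdisj : Disjoint D U)
    {a b : ℕ} (ha : a ≤ n + 2) (hb : b ≤ n + 2) (hT : IsTriangulation n D U T) :
    crossing n D U T (a, b) = crossing n D U T (b, a) := by
  ext ⟨e, f⟩
  rw [crossing, crossing, Finset.mem_filter, Finset.mem_filter]
  refine and_congr_right fun hef => ?_
  obtain ⟨he, hf, -⟩ := (EdgeOf.joined hT (Or.inl hef)).bounds hT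
  rw [cross_iff hUD hdisj ha hb he hf, cross_iff hUD hdisj hb ha he hf]
  tauto

theorem gap_nonneg_and_pos (hUD : D ∪ U = Finset.Icc 1 (n + 1)) (hdisj : Disjoint D U)
    (hT : IsTriangulation n D U T) {a b : ℕ} (hab : a < b) (hb : b ≤ n + 2) :
    0 ≤ gap n D U T (a, b) ∧ (¬ EdgeOf n D U T a b → 0 < gap n D U T (a, b)) := by
  induction hr : (crossing n D U T (a, b)).card using Nat.strong_induction_on
    generalizing a b with
  | _ r ih =>
    subst hr
    by_cases hE : EdgeOf n D U T a b
    · have := hE.sum_Bel_eq hUD hdisj hT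
      exact ⟨by rw [gap, this, sub_self], fun h => absurd hE h⟩
    suffices 0 < gap n D U T (a, b) from ⟨this.le, fun _ => this⟩
    have ha : a ≤ n + 2 := by omega
    obtain ⟨⟨c, d⟩, hmem, hcr⟩ := exists_mem_cross hT hab hb hE
    have hEcd : EdgeOf n D U T c d := Or.inl hmem
    have hj := hEcd.joined hT
    obtain ⟨hcd, hd⟩ := hEcd.bounds hT
    have hc : c ≤ n + 2 := by omega
    have h0 : gap n D U T (c, d) = 0 := by
      rw [gap, hEcd.sum_Bel_eq hUD hdisj hT, sub_self]
    rw [cross_iff hUD hdisj ha hb hc hd] at hcr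
    rcases hcr with ⟨h1, h2⟩ | ⟨h1, h2⟩
    · obtain ⟨hcb, had⟩ := lt_of_crossing hUD hdisj hab hb hcd hd h1 h2
      have l1 := crossing_card_lt hUD hdisj hT ha hb hj ⟨_, hmem, Or.inl rfl⟩ h1 h2
      have l2 := crossing_card_lt hUD hdisj hT hb ha hj.symm ⟨_, hmem, Or.inr rfl⟩ h2 h1
      rw [crossing_swap hUD hdisj hd ha hT, crossing_swap hUD hdisj hb ha hT] at l2
      have g1 := (ih _ l1 hcb hb rfl).1
      have g2 := (ih _ l2 had hd rfl).1
      have := gap_add_gap_lt (T := T) hUD hdisj hab hb hcd hd h1 h2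
      linarith
    · have k1 : Cyc (pos n D U c) (pos n D U a) (pos n D U d) :=
        (h1.trans_left h2.rotate.rotate).1.rotate.rotate
      have k2 : Cyc (pos n D U d) (pos n D U b) (pos n D U c) :=
        (h1.trans_left h2.rotate.rotate).2
      obtain ⟨had, hcb⟩ := lt_of_crossing hUD hdisj hcd hd hab hb k1 k2
      have l1 := crossing_card_lt' hUD hdisj hT ha hb hj.symm ⟨_, hmem, Or.inr rfl⟩ h1 h2
      have l2 := crossing_card_lt' hUD hdisj hT hb ha hj ⟨_, hmem, Or.inl rfl⟩ h2 h1
      rw [crossing_swap hUD hdisj hb hc hT, crossing_swap hUD hdisj hb ha hT] at l2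
      have g1 := (ih _ l1 had hd rfl).1
      have g2 := (ih _ l2 hcb hb rfl).1
      have := gap_add_gap_lt (T := T) hUD hdisj hcd hd hab hb k1 k2
      linarith

end Gap

/-- For every triangulation `T` of `P` and every internal diagonal `δ`,
equality `∑_{j∈Bel(δ)} x_j(T) = (bel(δ)+1)·bel(δ)/2` holds iff `δ ∈ T`. -/
theorem bel_sum_eq_iff_mem (n : ℕ) (hn : 1 ≤ n) (D U : Finset ℕ)
    (hUD : D ∪ U = Finset.Icc 1 (n + 1)) (hdisj : Disjoint D U)
    (T : Finset (ℕ × ℕ)) (hT : IsTriangulation n D U T)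
    (δ : ℕ × ℕ) (hδ : IsInternalDiag n D U δ) :
    (∑ j ∈ Bel n D U δ, xcoord n D U T j = ((bel n D U δ : ℝ) + 1) * (bel n D U δ : ℝ) / 2)
      ↔ δ ∈ T := by
  obtain ⟨a, b⟩ := δ
  constructor
  · intro h
    by_contra hmem
    have hpos := (gap_nonneg_and_pos hUD hdisj hT hδ.1.1 hδ.1.2).2 (not_or.2 ⟨hmem, hδ.2⟩)
    rw [gap, h, sub_self] at hpos
    exact hpos.false
  · intro h
    exact EdgeOf.sum_Bel_eq hUD hdisj hT (Or.inl h)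

end Spines
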